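/- Let G be a finite abelian group of order v, D ⊆ G a difference set with |D| = k, 0 < k < v, parameter Λ, and H a subgroup of G of order h such that D is H-fine with associated natural number s. For each character γ of G, let E_γ be the complex matrix with rows indexed by D and columns indexed by the nonidentity cosets of H in G, with entry E_γ(d, ḡ) = √(s/k)·γ(d) if d + H = ḡ and 0 otherwise. Then for every character γ of G, the matrix E_γ is an isometry: E_γᴴ E_γ = I, where ᴴ denotes conjugate transpose; moreover for any two characters γ, γ' of G the cross-Gram matrix E_γᴴ E_γ' is diagonal, with diagonal entry at ḡ equal to (s/k)·∑_{d ∈ D, d + H = ḡ} conj(γ(d))·γ'(d). -/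

import Mathlib

open scoped Classical
open Matrix

/-- The matrix `E_γ`, with rows indexed by `D` and columns indexed by the nonidentity cosets
of `H`, with entry `√(s/k)·γ(d)` in position `(d, ḡ)` when `d + H = ḡ`, and `0` otherwise. -/
noncomputable def Efun {G : Type*} [AddCommGroup G] (H : AddSubgroup G) (D : Finset G)
    (s : ℕ) (γ : AddChar G ℂ) : Matrix {d : G // d ∈ D} {c : G ⧸ H // c ≠ 0} ℂ :=
  fun d c => if (QuotientAddGroup.mk d.1 : G ⧸ H) = c.1
    then ((Real.sqrt ((s : ℝ) / (D.card : ℝ)) : ℝ) : ℂ) * γ d.1 else 0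

/-- The number of ordered pairs of elements of `D` lying in a common coset of `H` is the sum of
the squares of the numbers of elements of `D` in the cosets. -/
theorem card_pairs_same_coset {G : Type*} [AddCommGroup G] (D : Finset G) (H : AddSubgroup G)
    [Fintype (G ⧸ H)] :
    ((D ×ˢ D).filter (fun p => p.1 - p.2 ∈ H)).card =
      ∑ c : G ⧸ H, (D.filter (fun d => (QuotientAddGroup.mk d : G ⧸ H) = c)).card ^ 2 := by
  rw [Finset.card_eq_sum_card_fiberwise (t := Finset.univ)
    (f := fun p : G × G => (QuotientAddGroup.mk p.1 : G ⧸ H)) (fun _ _ => by simp)]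
  refine Finset.sum_congr rfl fun c _ => ?_
  rw [sq, ← Finset.card_product]
  congr 1
  ext ⟨a, b⟩
  have key : a - b ∈ H ↔ (QuotientAddGroup.mk a : G ⧸ H) = QuotientAddGroup.mk b := by
    rw [QuotientAddGroup.eq_iff_sub_mem]
  simp only [Finset.mem_filter, Finset.mem_product, key]
  constructor
  · rintro ⟨⟨⟨ha, hb⟩, h⟩, rfl⟩
    exact ⟨⟨ha, rfl⟩, hb, h.symm⟩
  · rintro ⟨⟨ha, rfl⟩, hb, h⟩
    exact ⟨⟨⟨ha, hb⟩, h.symm⟩, rfl⟩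

/-- In a difference set, the number of ordered pairs whose difference lies in a subgroup `H`. -/
theorem card_pairs_sub_mem {G : Type*} [AddCommGroup G] [Fintype G] (D : Finset G) (Λ : ℕ)
    (hD : ∀ g : G, g ≠ 0 → ((D ×ˢ D).filter (fun p => p.1 - p.2 = g)).card = Λ)
    (H : AddSubgroup G) :
    ((D ×ˢ D).filter (fun p => p.1 - p.2 ∈ H)).card = D.card + (Nat.card H - 1) * Λ := by
  have hcard : (Finset.univ.filter (fun g : G => g ∈ H)).card = Nat.card H := by
    rw [Nat.card_eq_fintype_card, Fintype.card_subtype]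
  have h0 : (0 : G) ∈ Finset.univ.filter (fun g : G => g ∈ H) := by simp [H.zero_mem]
  rw [Finset.card_eq_sum_card_fiberwise (t := Finset.univ.filter (fun g : G => g ∈ H))
    (f := fun p : G × G => p.1 - p.2) (fun p hp => by simpa using (Finset.mem_filter.1 hp).2),
    ← Finset.add_sum_erase _ _ h0]
  congr 1
  · rw [Finset.filter_filter, ← Finset.diag_card D]
    congr 1
    ext ⟨a, b⟩
    simp only [Finset.mem_filter, Finset.mem_product, Finset.mem_diag, sub_eq_zero]
    constructor
    · rintro ⟨⟨ha, hb⟩, -, h⟩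
      exact ⟨ha, h⟩
    · rintro ⟨ha, rfl⟩
      exact ⟨⟨ha, ha⟩, by simp [H.zero_mem], rfl⟩
  · rw [← hcard, ← Finset.card_erase_of_mem h0, ← smul_eq_mul]
    refine Finset.sum_const_nat (fun g hg => ?_)
    obtain ⟨hg0, hgH⟩ := Finset.mem_erase.1 hg
    rw [← hD g hg0, Finset.filter_filter]
    congr 1
    refine Finset.filter_congr fun p _ => ⟨fun h => h.2, fun h => ⟨?_, h⟩⟩
    rw [h]
    exact (Finset.mem_filter.1 hgH).2

/-- An `H`-fine difference set meets every nonidentity coset of `H` in `k / s` elements. -/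
theorem mul_card_coset_eq {G : Type*} [AddCommGroup G] [Fintype G]
    (D : Finset G) (Λ : ℕ)
    (hk0 : 0 < D.card) (hkv : D.card < Fintype.card G)
    (hD : ∀ g : G, g ≠ 0 → ((D ×ˢ D).filter (fun p => p.1 - p.2 = g)).card = Λ)
    (H : AddSubgroup G) (s : ℕ)
    (hdisj : ∀ x ∈ D, x ∉ H)
    (hfine : Nat.card H * (s + 1) = Fintype.card G)
    (hS : s ^ 2 * (Fintype.card G - D.card) = D.card * (Fintype.card G - 1))
    (c : G ⧸ H) (hc : c ≠ 0) :
    s * (D.filter (fun d => (QuotientAddGroup.mk d : G ⧸ H) = c)).card = D.card := by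
  have := Fintype.ofFinite (G ⧸ H)
  have hpairs := card_pairs_sub_mem D Λ hD H
  rw [card_pairs_same_coset] at hpairs
  have hpairsTop := card_pairs_sub_mem D Λ hD ⊤
  rw [Finset.filter_true_of_mem (fun _ _ => AddSubgroup.mem_top _), Finset.card_product,
    AddSubgroup.card_top, Nat.card_eq_fintype_card] at hpairsTop
  have hsum := Finset.card_eq_sum_card_fiberwise (s := D) (t := Finset.univ)
    (f := fun d : G => (QuotientAddGroup.mk d : G ⧸ H)) (fun _ _ => by simp)
  have hzero : (D.filter (fun d => (QuotientAddGroup.mk d : G ⧸ H) = 0)).card = 0 := by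
    rw [Finset.card_eq_zero, Finset.filter_eq_empty_iff]
    intro x hx h
    exact hdisj x hx ((QuotientAddGroup.eq_zero_iff x).1 h)
  have hh : 0 < Nat.card H := Nat.card_pos
  have hindex : Fintype.card (G ⧸ H) = s + 1 := by
    have h1 := AddSubgroup.card_eq_card_quotient_mul_card_addSubgroup H
    rw [Nat.card_eq_fintype_card, Nat.card_eq_fintype_card (α := G ⧸ H), ← hfine, mul_comm] at h1
    exact (Nat.eq_of_mul_eq_mul_right hh h1).symm
  have hcard : (Finset.univ.erase (0 : G ⧸ H)).card = s := by
    rw [Finset.card_erase_of_mem (Finset.mem_univ _), Finset.card_univ, hindex]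
    simp
  rw [← Finset.add_sum_erase _ _ (Finset.mem_univ (0 : G ⧸ H)), hzero] at hpairs hsum
  generalize hv : Fintype.card G = v at *
  generalize D.card = k at *
  generalize Nat.card H = h at *
  set a : G ⧸ H → ℕ := fun c => (D.filter (fun d => (QuotientAddGroup.mk d : G ⧸ H) = c)).card
    with ha
  change s * a c = k
  have hsumZ : ∑ x ∈ Finset.univ.erase (0 : G ⧸ H), (a x : ℤ) = k := by
    rw [hsum]
    push_cast
    simp [ha]
  have hsqZ : ∑ x ∈ Finset.univ.erase (0 : G ⧸ H), (a x : ℤ) ^ 2 = k + (h - 1) * Λ := by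
    zify [hh] at hpairs
    rw [← hpairs]
    simp [ha]
  have hv1 : 1 ≤ v := by omega
  zify [hkv.le, hv1] at hS hfine hpairsTop hk0 hkv
  have hs : (s : ℤ) + 1 ≠ 0 := by positivity
  have hfinek : (h : ℤ) * s ^ 2 = k * (s + h - 1) := by
    apply mul_left_cancel₀ hs
    rw [← hfine] at hS
    linear_combination hS
  have hΛ : ((v : ℤ) - 1) * Λ = k * (k - 1) := by linear_combination -hpairsTop
  have hsq : (s : ℤ) * (k + (h - 1) * Λ) = k ^ 2 := by
    have hv0 : (v : ℤ) - 1 ≠ 0 := by omega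
    apply mul_left_cancel₀ hv0
    rw [← hfine] at hΛ ⊢
    linear_combination (s : ℤ) * (h - 1) * hΛ + k * hfinek
  have hvar : ∑ x ∈ Finset.univ.erase (0 : G ⧸ H), ((s : ℤ) * a x - k) ^ 2 = 0 := by
    have hexp : ∀ x, ((s : ℤ) * a x - k) ^ 2 =
        s ^ 2 * (a x : ℤ) ^ 2 - 2 * s * k * a x + k ^ 2 := fun x => by ring
    simp only [hexp]
    rw [Finset.sum_add_distrib, Finset.sum_sub_distrib, ← Finset.mul_sum, ← Finset.mul_sum,
      hsumZ, hsqZ, Finset.sum_const, hcard, nsmul_eq_mul]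
    linear_combination (s : ℤ) * hsq
  have hterm := (Finset.sum_eq_zero_iff_of_nonneg (fun x _ => sq_nonneg _)).1 hvar c
    (Finset.mem_erase.2 ⟨hc, Finset.mem_univ c⟩)
  have hlin := pow_eq_zero_iff (two_ne_zero) |>.1 hterm
  zify
  linarith

/-- The matrices `E_γ` have diagonal cross-Gram matrices. -/
theorem Efun_conjTranspose_mul_apply {G : Type*} [AddCommGroup G] (H : AddSubgroup G)
    (D : Finset G) (s : ℕ) (γ γ' : AddChar G ℂ) (c c' : {c : G ⧸ H // c ≠ 0}) :
    ((Efun H D s γ)ᴴ * Efun H D s γ') c c' =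
      if c = c' then ((s : ℂ) / (D.card : ℂ)) *
        ∑ d ∈ D.filter (fun d => (QuotientAddGroup.mk d : G ⧸ H) = c.1), star (γ d) * γ' d
      else 0 := by
  rw [Matrix.mul_apply]
  simp only [Matrix.conjTranspose_apply, Efun]
  split_ifs with h
  · subst h
    have hroot : ((Real.sqrt ((s : ℝ) / D.card) : ℝ) : ℂ) * (Real.sqrt ((s : ℝ) / D.card) : ℝ) =
        (s : ℂ) / D.card := by
      rw [← Complex.ofReal_mul, Real.mul_self_sqrt (by positivity)]
      push_cast
      rfl
    rw [Finset.sum_filter, Finset.mul_sum, ← Finset.sum_coe_sort D]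
    refine Finset.sum_congr rfl fun d _ => ?_
    split_ifs
    · rw [star_mul', ← hroot]
      simp only [Complex.star_def, Complex.conj_ofReal]
      ring
    · simp
  · refine Finset.sum_eq_zero fun d _ => ?_
    split_ifs with h1 h2
    · exact absurd (Subtype.ext (h1.symm.trans h2)) h
    all_goals simp

/-- If `D` is an `H`-fine difference set with associated natural number `s`,
then each `E_γ` is an isometry, and each cross-Gram matrix `E_γᴴ E_γ'` is diagonal with
diagonal entry `(s/k)·∑_{d ∈ D, d+H = ḡ} conj(γ(d))·γ'(d)` at `ḡ`. -/
theorem stmt_5 {G : Type*} [AddCommGroup G] [Fintype G]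
    (D : Finset G) (Λ : ℕ)
    (hk0 : 0 < D.card) (hkv : D.card < Fintype.card G)
    (hD : ∀ g : G, g ≠ 0 → ((D ×ˢ D).filter (fun p => p.1 - p.2 = g)).card = Λ)
    (H : AddSubgroup G) (s : ℕ)
    (hdisj : ∀ x ∈ D, x ∉ H)
    (hfine : Nat.card H * (s + 1) = Fintype.card G)
    (hS : s ^ 2 * (Fintype.card G - D.card) = D.card * (Fintype.card G - 1)) :
    (∀ γ : AddChar G ℂ, (Efun H D s γ)ᴴ * Efun H D s γ = 1) ∧
    (∀ γ γ' : AddChar G ℂ,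
      (∀ c c' : {c : G ⧸ H // c ≠ 0}, c ≠ c' →
        ((Efun H D s γ)ᴴ * Efun H D s γ') c c' = 0) ∧
      (∀ c : {c : G ⧸ H // c ≠ 0},
        ((Efun H D s γ)ᴴ * Efun H D s γ') c c =
          ((s : ℂ) / (D.card : ℂ)) *
            ∑ d ∈ D.filter (fun d => (QuotientAddGroup.mk d : G ⧸ H) = c.1),
              star (γ d) * γ' d)) := by
  refine ⟨fun γ => ?_, fun γ γ' => ⟨fun c c' h => ?_, fun c => ?_⟩⟩
  · ext c c'
    rw [Efun_conjTranspose_mul_apply, Matrix.one_apply]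
    refine if_congr Iff.rfl ?_ rfl
    have hunit : ∀ d : G, star (γ d) * γ d = 1 := fun d => by
      rw [Complex.star_def, Complex.conj_mul', AddChar.norm_apply]
      simp
    have hfiber := mul_card_coset_eq D Λ hk0 hkv hD H s hdisj hfine hS c.1 c.2
    have hk : (D.card : ℂ) ≠ 0 := Nat.cast_ne_zero.2 hk0.ne'
    simp only [hunit, Finset.sum_const, nsmul_eq_mul, mul_one]
    rw [div_mul_eq_mul_div, div_eq_one_iff_eq hk]
    exact_mod_cast hfiber
  · rw [Efun_conjTranspose_mul_apply, if_neg h]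
  · rw [Efun_conjTranspose_mul_apply, if_pos rfl]
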